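/- (Biot–Savart law in polar coordinates, per Fourier mode.) Fix r_0 > 0, v_∞ ∈ ℝ and k ∈ ℤ. Let w_k : (r_0, ∞) → ℂ be continuous with √s·w_k(s) ∈ L¹(r_0, ∞) if k ≠ 0 and s·w_0(s) ∈ L¹(r_0, ∞) if k = 0, and assume the integral relation ∫_{r_0}^∞ s^{−|k|+1}·w_k(s) ds = i·v_∞·δ_{|k|,1}·sign(k)/r_0^{|k|−1} (which for k = 0 reads ∫_{r_0}^∞ s·w_0(s) ds = 0). Then there exists exactly one bounded differentiable pair (v_r, v_φ) on (r_0, ∞), extending continuously to [r_0, ∞), that solves the k-th Fourier-mode div–curl system with datum w_k, satisfies v_r(r_0) = v_φ(r_0) = 0, and satisfies v_r(r) → δ_{|k|,1}·v_∞/2 and v_φ(r) → −sign(k)·δ_{|k|,1}·v_∞/(2i) as r → ∞; it is given by v_r(r) = sign(k)·(i·r^{−|k|−1}/2)·∫_{r_0}^r s^{|k|+1}·w_k(s) ds + sign(k)·(i·r^{|k|−1}/2)·∫_r^∞ s^{−|k|+1}·w_k(s) ds + δ_{|k|,1}·v_∞/2 and v_φ(r) = (r^{−|k|−1}/2)·∫_{r_0}^r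 s^{|k|+1}·w_k(s) ds − (r^{|k|−1}/2)·∫_r^∞ s^{−|k|+1}·w_k(s) ds − sign(k)·δ_{|k|,1}·v_∞/(2i). -/

import Mathlib

open Complex Set Filter MeasureTheory

/-- The `k`-th Fourier-mode div–curl system in polar coordinates on `(r₀, ∞)`. -/
def DivCurlSystem (r₀ : ℝ) (k : ℤ) (vr vφ w : ℝ → ℂ) : Prop :=
  ∀ r : ℝ, r₀ < r →
    (1 / (r : ℂ)) * deriv (fun ρ : ℝ => (ρ : ℂ) * vr ρ) r + (Complex.I * k / r) * vφ r = 0 ∧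
    (1 / (r : ℂ)) * deriv (fun ρ : ℝ => (ρ : ℂ) * vφ ρ) r - (Complex.I * k / r) * vr r = w r

/-- Kronecker delta `δ_{|k|,1}`. -/
noncomputable def deltaAbs1 (k : ℤ) : ℂ := if k.natAbs = 1 then 1 else 0

/-- Radial component of the Biot–Savart law in polar coordinates. -/
noncomputable def vrBS (r₀ : ℝ) (vinf : ℝ) (k : ℤ) (w : ℝ → ℂ) (r : ℝ) : ℂ :=
  (Int.sign k : ℂ) * (Complex.I * (r : ℂ) ^ (-(k.natAbs : ℤ) - 1) / 2) *
      (∫ s in r₀..r, (s : ℂ) ^ ((k.natAbs : ℤ) + 1) * w s)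
    + (Int.sign k : ℂ) * (Complex.I * (r : ℂ) ^ ((k.natAbs : ℤ) - 1) / 2) *
      (∫ s in Set.Ioi r, (s : ℂ) ^ (-(k.natAbs : ℤ) + 1) * w s)
    + deltaAbs1 k * vinf / 2

/-- Angular component of the Biot–Savart law in polar coordinates. -/
noncomputable def vφBS (r₀ : ℝ) (vinf : ℝ) (k : ℤ) (w : ℝ → ℂ) (r : ℝ) : ℂ :=
  ((r : ℂ) ^ (-(k.natAbs : ℤ) - 1) / 2) *
      (∫ s in r₀..r, (s : ℂ) ^ ((k.natAbs : ℤ) + 1) * w s)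
    - ((r : ℂ) ^ ((k.natAbs : ℤ) - 1) / 2) *
      (∫ s in Set.Ioi r, (s : ℂ) ^ (-(k.natAbs : ℤ) + 1) * w s)
    - (Int.sign k : ℂ) * deltaAbs1 k * vinf / (2 * Complex.I)

/-- Requirements on a velocity pair in the Biot–Savart theorem: bounded, differentiable on
`(r₀,∞)`, continuous up to the boundary, solving the system, no-slip at `r₀` and prescribed
limit at infinity. -/
def BSGood (r₀ : ℝ) (vinf : ℝ) (k : ℤ) (w vr vφ : ℝ → ℂ) : Prop :=
  (∃ C : ℝ, ∀ r ∈ Set.Ici r₀, ‖vr r‖ ≤ C ∧ ‖vφ r‖ ≤ C) ∧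
  (∀ r : ℝ, r₀ < r → DifferentiableAt ℝ vr r ∧ DifferentiableAt ℝ vφ r) ∧
  ContinuousOn vr (Set.Ici r₀) ∧ ContinuousOn vφ (Set.Ici r₀) ∧
  DivCurlSystem r₀ k vr vφ w ∧
  vr r₀ = 0 ∧ vφ r₀ = 0 ∧
  Tendsto vr atTop (nhds (deltaAbs1 k * vinf / 2)) ∧
  Tendsto vφ atTop (nhds (-(Int.sign k : ℂ) * deltaAbs1 k * vinf / (2 * Complex.I)))

lemma bs_prim (r₀ : ℝ) (g : ℝ → ℂ) (hg : ContinuousOn g (Ioi r₀))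
    (hi : ∀ r, r₀ ≤ r → IntervalIntegrable g volume r₀ r) :
    ContinuousOn (fun r => ∫ s in r₀..r, g s) (Ici r₀) ∧
    ∀ r, r₀ < r → HasDerivAt (fun r => ∫ s in r₀..r, g s) (g r) r := by
  constructor
  · intro x hx
    have hx' : r₀ ≤ x := hx
    have h1 : ContinuousOn (fun r => ∫ s in r₀..r, g s) (uIcc r₀ (x+1)) := by
      apply intervalIntegral.continuousOn_primitive_interval
      rw [← intervalIntegrable_iff']
      exact hi _ (by linarith)
    have h2 := h1 x (by rw [uIcc_of_le (by linarith)]; exact ⟨hx', by linarith⟩)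
    rw [uIcc_of_le (by linarith)] at h2
    refine h2.mono_of_mem_nhdsWithin ?_
    have : Iio (x+1) ∈ nhds x := Iio_mem_nhds (by linarith)
    filter_upwards [mem_nhdsWithin_of_mem_nhds this, self_mem_nhdsWithin] with y hy hy2
    exact ⟨hy2, le_of_lt hy⟩
  · intro r hr
    have hc : ContinuousAt g r := hg.continuousAt (Ioi_mem_nhds hr)
    refine intervalIntegral.integral_hasDerivAt_right (hi r hr.le) ?_ hc
    exact hg.stronglyMeasurableAtFilter isOpen_Ioi r hr

lemma bs_zpow_cont (r₀ : ℝ) (hr₀ : 0 < r₀) (m : ℤ) :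
    ContinuousOn (fun s : ℝ => (s : ℂ) ^ m) (Ici r₀) := by
  intro x hx
  have hx' : r₀ ≤ x := hx
  have : (x : ℂ) ≠ 0 := by exact_mod_cast (by linarith : (0:ℝ) < x).ne'
  exact (Complex.continuous_ofReal.continuousAt.zpow₀ m (Or.inl this)).continuousWithinAt

lemma bs_zpow_deriv (r : ℝ) (hr : 0 < r) (m : ℤ) :
    HasDerivAt (fun s : ℝ => (s : ℂ) ^ m) (m * (r:ℂ)^(m-1)) r := by
  have : (r : ℂ) ≠ 0 := by exact_mod_cast hr.ne'
  exact (hasDerivAt_zpow m (r:ℂ) (Or.inl this)).comp_ofReal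

lemma bs_weight (k : ℤ) (r₀ : ℝ) (hr₀ : 0 < r₀) (w : ℝ → ℂ)
    (hL1 : k ≠ 0 → IntegrableOn (fun s : ℝ => (Real.sqrt s : ℂ) * w s) (Set.Ioi r₀))
    (hL10 : k = 0 → IntegrableOn (fun s : ℝ => (s : ℂ) * w s) (Set.Ioi r₀)) :
    ∃ u : ℝ → ℝ, IntegrableOn (fun s : ℝ => (u s : ℂ) * w s) (Ioi r₀) ∧
      (∀ r, 0 < r → 0 < u r) ∧ Tendsto u atTop atTop ∧
      (∀ r s, 0 < s → s ≤ r →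
        r ^ (-(k.natAbs : ℤ) - 1) * s ^ ((k.natAbs : ℤ) + 1) * u r ≤ u s) ∧
      (∀ r s, 0 < r → r ≤ s →
        r ^ ((k.natAbs : ℤ) - 1) * s ^ (-(k.natAbs : ℤ) + 1) * u r ≤ u s) := by
  by_cases hk : k = 0
  · refine ⟨fun s => s, hL10 hk, fun r hr => hr, tendsto_id, ?_, ?_⟩
    · intro r s hs hsr
      have : 0 < r := by linarith
      subst hk
      simp
      field_simp
      rfl
    · intro r s hr hrs
      subst hk
      simp
      field_simp
      rfl
  · obtain ⟨n, hn⟩ : ∃ n : ℕ, k.natAbs = n + 1 := ⟨k.natAbs - 1, by omega⟩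
    refine ⟨Real.sqrt, hL1 hk, fun r hr => Real.sqrt_pos.2 hr, Real.tendsto_sqrt_atTop, ?_, ?_⟩
    · intro r s hs hsr
      have hr : 0 < r := by linarith
      rw [hn]
      have e1 : r ^ (-((n + 1 : ℕ) : ℤ) - 1) * s ^ (((n+1 : ℕ) : ℤ) + 1) = (s / r)^(n+1) * (s/r) := by
        have : (-((n + 1 : ℕ) : ℤ) - 1) = -((n+2 : ℕ) : ℤ) := by push_cast; ring
        rw [this, zpow_neg, zpow_natCast]
        have : (((n+1 : ℕ) : ℤ) + 1) = ((n+2 : ℕ) : ℤ) := by push_cast; ring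
        rw [this, zpow_natCast, ← pow_succ, div_pow]
        field_simp
      rw [e1]
      have h1 : (s / r)^(n+1) ≤ 1 := pow_le_one₀ (by positivity) ((div_le_one hr).2 hsr)
      have h2 : (s / r) * √r ≤ √s := by
        have a := Real.sq_sqrt hs.le
        have b := Real.sq_sqrt hr.le
        have c := Real.sqrt_le_sqrt hsr
        have d := Real.sqrt_pos.2 hs
        have e := Real.sqrt_pos.2 hr
        have : s / r * √r = √s * (√s / √r) := by
          rw [div_mul_eq_mul_div, mul_div_assoc', div_eq_div_iff hr.ne' e.ne']
          calc s * √r * √r = s * (√r^2) := by ring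
            _ = √s^2 * r := by rw [a, b]
            _ = _ := by ring
        rw [this]
        exact mul_le_of_le_one_right d.le ((div_le_one e).2 c)
      rw [mul_assoc]
      calc _ ≤ 1 * (s / r * √r) := by gcongr
        _ ≤ _ := by simpa using h2
    · intro r s hr hrs
      have hs : 0 < s := by linarith
      rw [hn]
      have e1 : r ^ (((n + 1 : ℕ) : ℤ) - 1) * s ^ (-((n+1 : ℕ) : ℤ) + 1) = (r / s)^n := by
        have : (-((n + 1 : ℕ) : ℤ) + 1) = -(n : ℤ) := by push_cast; ring
        rw [this, zpow_neg, zpow_natCast]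
        have : (((n+1 : ℕ) : ℤ) - 1) = (n : ℤ) := by push_cast; ring
        rw [this, zpow_natCast, div_pow]
        field_simp
      rw [e1]
      have h1 : (r / s)^n ≤ 1 := pow_le_one₀ (by positivity) ((div_le_one hs).2 hrs)
      calc _ ≤ 1 * √s := by gcongr
        _ = _ := one_mul _

lemma bs_norm_zpow (r : ℝ) (hr : 0 < r) (m : ℤ) : ‖(r : ℂ) ^ m‖ = r ^ m := by
  rw [norm_zpow, Complex.norm_real, Real.norm_of_nonneg hr.le]

/-- convergence of the two weighted integrals -/
lemma bs_lims (r₀ : ℝ) (hr₀ : 0 < r₀) (a b c d : ℤ) (w : ℝ → ℂ) (u : ℝ → ℝ)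
    (hu : IntegrableOn (fun s : ℝ => (u s : ℂ) * w s) (Ioi r₀))
    (hpos : ∀ r, 0 < r → 0 < u r) (hT : Tendsto u atTop atTop)
    (hA : ∀ r s, 0 < s → s ≤ r → r ^ a * s ^ b * u r ≤ u s)
    (hB : ∀ r s, 0 < r → r ≤ s → r ^ c * s ^ d * u r ≤ u s) :
    Tendsto (fun r : ℝ => (r : ℂ)^a * ∫ s in r₀..r, (s : ℂ)^b * w s) atTop (nhds 0) ∧
    Tendsto (fun r : ℝ => (r : ℂ)^c * ∫ s in Ioi r, (s : ℂ)^d * w s) atTop (nhds 0) := by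
  set M := ∫ s in Ioi r₀, ‖(u s : ℂ) * w s‖ with hM
  have hlim : Tendsto (fun r => (u r)⁻¹ * M) atTop (nhds 0) := by
    simpa using (tendsto_inv_atTop_zero.comp hT).mul_const M
  have key : ∀ r s (x y : ℝ), 0 < r → 0 < s → x * y * u r ≤ u s → x * (y * ‖w s‖) ≤ (u r)⁻¹ * ‖(u s : ℂ) * w s‖ := by
    intro r s x y hr hs h
    rw [norm_mul, Complex.norm_real, Real.norm_of_nonneg (hpos s hs).le]
    have := hpos r hr
    rw [inv_mul_eq_div, le_div_iff₀ this]
    calc _ = (x * y * u r) * ‖w s‖ := by ring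
      _ ≤ _ := by gcongr
  constructor
  · refine squeeze_zero_norm' ?_ hlim
    filter_upwards [eventually_gt_atTop r₀] with r hr
    have hr' : 0 < r := by linarith
    rw [← intervalIntegral.integral_const_mul, intervalIntegral.integral_of_le hr.le]
    calc _ ≤ ∫ s in Ioc r₀ r, (u r)⁻¹ * ‖(u s : ℂ) * w s‖ := by
          refine norm_integral_le_of_norm_le ((hu.mono_set Ioc_subset_Ioi_self).norm.const_mul _) ?_
          filter_upwards [ae_restrict_mem measurableSet_Ioc] with s hs
          have hs' : 0 < s := lt_trans hr₀ hs.1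
          rw [norm_mul, norm_mul, bs_norm_zpow r hr', bs_norm_zpow s hs']
          exact key r s _ _ hr' hs' (hA r s hs' hs.2)
      _ = (u r)⁻¹ * ∫ s in Ioc r₀ r, ‖(u s : ℂ) * w s‖ := integral_const_mul _ _
      _ ≤ _ := by
        have := hpos r hr'
        gcongr
        exact setIntegral_mono_set hu.norm (ae_of_all _ fun s => norm_nonneg _)
          (LE.le.eventuallyLE Ioc_subset_Ioi_self)
  · refine squeeze_zero_norm' ?_ hlim
    filter_upwards [eventually_gt_atTop r₀] with r hr
    have hr' : 0 < r := by linarith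
    have hsub : Ioi r ⊆ Ioi r₀ := Ioi_subset_Ioi hr.le
    rw [← integral_const_mul]
    calc _ ≤ ∫ s in Ioi r, (u r)⁻¹ * ‖(u s : ℂ) * w s‖ := by
          refine norm_integral_le_of_norm_le ((hu.mono_set hsub).norm.const_mul _) ?_
          filter_upwards [ae_restrict_mem measurableSet_Ioi] with s hs
          have hs' : 0 < s := lt_trans hr' hs
          rw [norm_mul, norm_mul, bs_norm_zpow r hr', bs_norm_zpow s hs']
          exact key r s _ _ hr' hs' (hB r s hr' (le_of_lt hs))
      _ = (u r)⁻¹ * ∫ s in Ioi r, ‖(u s : ℂ) * w s‖ := integral_const_mul _ _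
      _ ≤ _ := by
        have := hpos r hr'
        gcongr
        exact setIntegral_mono_set hu.norm (ae_of_all _ fun s => norm_nonneg _)
          (LE.le.eventuallyLE hsub)

lemma bs_bdd (r₀ : ℝ) (f : ℝ → ℂ) (l : ℂ) (hc : ContinuousOn f (Ici r₀))
    (hl : Tendsto f atTop (nhds l)) : ∃ C : ℝ, ∀ r ∈ Ici r₀, ‖f r‖ ≤ C := by
  have h1 : ∀ᶠ r in atTop, ‖f r‖ < ‖l‖ + 1 := hl.norm.eventually_lt_const (by linarith)
  obtain ⟨R, hR⟩ := eventually_atTop.1 h1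
  obtain ⟨C, hC⟩ := (isCompact_Icc (a := r₀) (b := R)).exists_bound_of_continuousOn
    (hc.mono Icc_subset_Ici_self)
  refine ⟨max C (‖l‖+1), fun r hr => ?_⟩
  rcases le_total r R with h | h
  · exact (hC r ⟨hr, h⟩).trans (le_max_left _ _)
  · exact (hR r h).le.trans (le_max_right _ _)

/-- a function on `[r₀,∞)` with `f' = m f / r`, vanishing at `r₀`, is zero -/
lemma bs_ode (r₀ : ℝ) (hr₀ : 0 < r₀) (m : ℤ) (f : ℝ → ℂ) (hc : ContinuousOn f (Ici r₀))
    (h0 : f r₀ = 0) (hd : ∀ r, r₀ < r → HasDerivAt f (m * f r / r) r) :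
    ∀ r ∈ Ici r₀, f r = 0 := by
  intro r hr
  have hr' : r₀ ≤ r := hr
  have hcont : ContinuousOn (fun s : ℝ => (s:ℂ)^(-m) * f s) (Icc r₀ r) :=
    ((bs_zpow_cont r₀ hr₀ (-m)).mul hc).mono Icc_subset_Ici_self
  have hder : ∀ x ∈ Ioo r₀ r, HasDerivAt (fun s : ℝ => (s:ℂ)^(-m) * f s) 0 x := by
    intro x hx
    have hx0 : 0 < x := lt_trans hr₀ hx.1
    have hxc : (x : ℂ) ≠ 0 := by exact_mod_cast hx0.ne'
    have := (bs_zpow_deriv x hx0 (-m)).mul (hd x hx.1)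
    refine HasDerivAt.congr_deriv (f := fun s : ℝ => (s:ℂ)^(-m) * f s) this ?_
    rw [zpow_sub_one₀ hxc]
    push_cast
    field_simp
    ring
  have hf : ((r:ℂ)^(-m) * f r) = ((r₀:ℂ)^(-m) * f r₀) := by
    have := intervalIntegral.integral_eq_sub_of_hasDerivAt_of_le hr' hcont hder
      (by simp)
    simp only [intervalIntegral.integral_zero] at this
    exact (sub_eq_zero.1 this.symm)
  rw [h0, mul_zero] at hf
  have hrc : (r : ℂ) ≠ 0 := by exact_mod_cast (lt_of_lt_of_le hr₀ hr').ne'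
  exact (mul_eq_zero.1 hf).resolve_left (zpow_ne_zero _ hrc)

lemma bs_unique (r₀ : ℝ) (hr₀ : 0 < r₀) (vinf : ℝ) (k : ℤ) (w vr vφ vr' vφ' : ℝ → ℂ)
    (h : BSGood r₀ vinf k w vr vφ) (h' : BSGood r₀ vinf k w vr' vφ') :
    ∀ r ∈ Ici r₀, vr r = vr' r ∧ vφ r = vφ' r := by
  obtain ⟨-, d, c1, c2, s, z1, z2, -, -⟩ := h
  obtain ⟨-, d', c1', c2', s', z1', z2', -, -⟩ := h'
  have hid : ∀ r : ℝ, HasDerivAt (fun ρ : ℝ => (ρ : ℂ)) 1 r := fun r =>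
    Complex.ofRealCLM.hasDerivAt
  have hco : ContinuousOn (fun ρ : ℝ => (ρ : ℂ)) (Ici r₀) := Complex.continuous_ofReal.continuousOn
  -- derivatives of the two differences
  have D : ∀ r, r₀ < r →
      HasDerivAt (fun ρ : ℝ => (ρ : ℂ) * vr ρ - ρ * vr' ρ) (-(I * k * (vφ r - vφ' r))) r ∧
      HasDerivAt (fun ρ : ℝ => (ρ : ℂ) * vφ ρ - ρ * vφ' ρ) (I * k * (vr r - vr' r)) r := by
    intro r hr
    have hrc : (r : ℂ) ≠ 0 := by exact_mod_cast (lt_trans hr₀ hr).ne'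
    have e1 := ((hid r).differentiableAt.mul (d r hr).1).hasDerivAt
    have e2 := ((hid r).differentiableAt.mul (d r hr).2).hasDerivAt
    have e1' := ((hid r).differentiableAt.mul (d' r hr).1).hasDerivAt
    have e2' := ((hid r).differentiableAt.mul (d' r hr).2).hasDerivAt
    obtain ⟨s1, s2⟩ := s r hr
    obtain ⟨s1', s2'⟩ := s' r hr
    constructor
    · refine (e1.sub e1').congr_deriv ?_
      have : (1 / (r:ℂ)) * (deriv (fun ρ : ℝ => (ρ : ℂ) * vr ρ) r - deriv (fun ρ : ℝ => (ρ : ℂ) * vr' ρ) r) = (1 / (r:ℂ)) * -(I * k * (vφ r - vφ' r)) := by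
        linear_combination s1 - s1'
      exact mul_left_cancel₀ (one_div_ne_zero hrc) this
    · refine (e2.sub e2').congr_deriv ?_
      have : (1 / (r:ℂ)) * (deriv (fun ρ : ℝ => (ρ : ℂ) * vφ ρ) r - deriv (fun ρ : ℝ => (ρ : ℂ) * vφ' ρ) r) = (1 / (r:ℂ)) * (I * k * (vr r - vr' r)) := by
        linear_combination s2 - s2'
      exact mul_left_cancel₀ (one_div_ne_zero hrc) this
  have P := bs_ode r₀ hr₀ (-k) (fun ρ : ℝ => ((ρ : ℂ) * vr ρ - ρ * vr' ρ) + I * ((ρ : ℂ) * vφ ρ - ρ * vφ' ρ))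
    (((hco.mul c1).sub (hco.mul c1')).add (continuousOn_const.mul ((hco.mul c2).sub (hco.mul c2'))))
    (by simp [z1, z2, z1', z2'])
    (by
      intro r hr
      have hrc : (r : ℂ) ≠ 0 := by exact_mod_cast (lt_trans hr₀ hr).ne'
      refine ((D r hr).1.add ((D r hr).2.const_mul I)).congr_deriv ?_
      push_cast
      field_simp
      linear_combination ((k:ℂ) * (vr r - vr' r)) * I_sq)
  have Q := bs_ode r₀ hr₀ k (fun ρ : ℝ => ((ρ : ℂ) * vr ρ - ρ * vr' ρ) - I * ((ρ : ℂ) * vφ ρ - ρ * vφ' ρ))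
    (((hco.mul c1).sub (hco.mul c1')).sub (continuousOn_const.mul ((hco.mul c2).sub (hco.mul c2'))))
    (by simp [z1, z2, z1', z2'])
    (by
      intro r hr
      have hrc : (r : ℂ) ≠ 0 := by exact_mod_cast (lt_trans hr₀ hr).ne'
      refine ((D r hr).1.sub ((D r hr).2.const_mul I)).congr_deriv ?_
      field_simp
      linear_combination (-(k:ℂ) * (vr r - vr' r)) * I_sq)
  intro r hr
  have hrc : (r : ℂ) ≠ 0 := by exact_mod_cast (lt_of_lt_of_le hr₀ hr).ne'
  have p := P r hr
  have q := Q r hr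
  constructor
  · apply mul_left_cancel₀ hrc
    linear_combination (p + q) / 2
  · apply mul_left_cancel₀ (mul_ne_zero I_ne_zero hrc)
    linear_combination (p - q) / 2

lemma bs_good (r₀ : ℝ) (hr₀ : 0 < r₀) (vinf : ℝ) (k : ℤ)
    (w : ℝ → ℂ) (hw : ContinuousOn w (Set.Ioi r₀))
    (hL1 : k ≠ 0 → IntegrableOn (fun s : ℝ => (Real.sqrt s : ℂ) * w s) (Set.Ioi r₀))
    (hL10 : k = 0 → IntegrableOn (fun s : ℝ => (s : ℂ) * w s) (Set.Ioi r₀))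
    (hrel : (∫ s in Set.Ioi r₀, (s : ℂ) ^ (-(k.natAbs : ℤ) + 1) * w s)
      = Complex.I * vinf * deltaAbs1 k * (Int.sign k : ℂ) / (r₀ : ℂ) ^ ((k.natAbs : ℤ) - 1)) :
    BSGood r₀ vinf k w (vrBS r₀ vinf k w) (vφBS r₀ vinf k w) := by
  obtain ⟨u, hu, hpos, hT, hA, hB⟩ := bs_weight k r₀ hr₀ w hL1 hL10
  obtain ⟨tA, tB⟩ := bs_lims r₀ hr₀ _ _ _ _ w u hu hpos hT hA hB
  have hk : (k : ℂ) = (Int.sign k : ℂ) * ((k.natAbs : ℤ) : ℂ) := by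
    exact_mod_cast (Int.sign_mul_natAbs k).symm
  have hσδ : (Int.sign k : ℂ) * (Int.sign k : ℂ) * deltaAbs1 k = deltaAbs1 k := by
    unfold deltaAbs1
    split_ifs with h
    · rcases Int.natAbs_eq k with h' | h' <;> rw [h', h] <;> simp
    · simp
  have hnδ : ((k.natAbs : ℤ) : ℂ) * deltaAbs1 k = deltaAbs1 k := by
    unfold deltaAbs1
    split_ifs with h
    · simp [h]
    · simp
  have hσn : (Int.sign k : ℂ) * (Int.sign k : ℂ) * ((k.natAbs : ℤ) : ℂ) = ((k.natAbs : ℤ) : ℂ) := by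
    have : Int.sign k * Int.sign k * (k.natAbs : ℤ) = (k.natAbs : ℤ) := by
      rcases lt_trichotomy k 0 with h | h | h
      · simp [Int.sign_eq_neg_one_of_neg h]
      · simp [h]
      · simp [Int.sign_eq_one_of_pos h]
    exact_mod_cast this
  unfold BSGood DivCurlSystem vrBS vφBS
  generalize hn : (k.natAbs : ℤ) = n at *
  generalize deltaAbs1 k = δ at *
  generalize (Int.sign k : ℂ) = σ at *
  rw [hk]
  -- integrability
  have hgc : ∀ m : ℤ, ContinuousOn (fun s : ℝ => (s:ℂ)^m * w s) (Ioi r₀) := fun m =>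
    ((bs_zpow_cont r₀ hr₀ m).mono Ioi_subset_Ici_self).mul hw
  have hg : IntegrableOn (fun s : ℝ => (s:ℂ)^(-n+1) * w s) (Ioi r₀) := by
    refine Integrable.mono' (hu.norm.const_mul (r₀ ^ (n-1) * u r₀)⁻¹)
      ((hgc _).aestronglyMeasurable measurableSet_Ioi) ?_
    filter_upwards [ae_restrict_mem measurableSet_Ioi] with s hs
    have hs0 : 0 < s := lt_trans hr₀ hs
    have hp := hpos _ hr₀
    have hp2 : 0 < r₀ ^ (n-1) := zpow_pos hr₀ _
    rw [norm_mul, bs_norm_zpow s hs0, norm_mul, Complex.norm_real, Real.norm_of_nonneg (hpos s hs0).le,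
      inv_mul_eq_div, le_div_iff₀ (by positivity)]
    have := hB r₀ s hr₀ (le_of_lt hs)
    calc _ = (r₀ ^ (n-1) * s ^ (-n+1) * u r₀) * ‖w s‖ := by ring
      _ ≤ _ := by gcongr
  have hgi : ∀ r, r₀ ≤ r → IntervalIntegrable (fun s : ℝ => (s:ℂ)^(-n+1) * w s) volume r₀ r := by
    intro r hr
    rw [intervalIntegrable_iff_integrableOn_Ioc_of_le hr]
    exact hg.mono_set Ioc_subset_Ioi_self
  have hhi : ∀ r, r₀ ≤ r → IntervalIntegrable (fun s : ℝ => (s:ℂ)^(n+1) * w s) volume r₀ r := by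
    intro r hr
    have h1 := (hgi r hr).continuousOn_mul (g := fun s : ℝ => (s:ℂ)^(2*n))
      ((bs_zpow_cont r₀ hr₀ (2*n)).mono (by rw [uIcc_of_le hr]; exact Icc_subset_Ici_self))
    refine h1.congr ?_
    intro s hs
    rw [uIoc_of_le hr] at hs
    have hsc : (s : ℂ) ≠ 0 := by exact_mod_cast (lt_trans hr₀ hs.1).ne'
    simp only
    rw [← mul_assoc, ← zpow_add₀ hsc]
    congr 2
    ring
  obtain ⟨cA, dA⟩ := bs_prim r₀ _ (hgc (n+1)) hhi
  obtain ⟨cG, dG⟩ := bs_prim r₀ _ (hgc (-n+1)) hgi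
  have hBeq : ∀ r, r₀ ≤ r → (∫ s in Ioi r, (s:ℂ)^(-n+1) * w s) =
      (∫ s in Ioi r₀, (s:ℂ)^(-n+1) * w s) - ∫ s in r₀..r, (s:ℂ)^(-n+1) * w s := by
    intro r hr
    rw [intervalIntegral.integral_of_le hr, eq_sub_iff_add_eq, add_comm,
      ← setIntegral_union (Ioc_disjoint_Ioi le_rfl) measurableSet_Ioi
        (hg.mono_set Ioc_subset_Ioi_self) (hg.mono_set (Ioi_subset_Ioi hr)),
      Ioc_union_Ioi_eq_Ioi hr]
  have cB : ContinuousOn (fun r : ℝ => ∫ s in Ioi r, (s:ℂ)^(-n+1) * w s) (Ici r₀) :=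
    (continuousOn_const.sub cG).congr hBeq
  have dB : ∀ r, r₀ < r → HasDerivAt (fun r : ℝ => ∫ s in Ioi r, (s:ℂ)^(-n+1) * w s)
      (-((r:ℂ)^(-n+1) * w r)) r := by
    intro r hr
    refine ((dG r hr).const_sub (∫ s in Ioi r₀, (s:ℂ)^(-n+1) * w s)).congr_of_eventuallyEq ?_
    filter_upwards [Ioi_mem_nhds hr] with x hx
    exact hBeq x (le_of_lt hx)
  have hA0 : (∫ s in r₀..r₀, (s:ℂ)^(n+1) * w s) = 0 := intervalIntegral.integral_same
  have hr₀c : (r₀ : ℂ) ≠ 0 := by exact_mod_cast hr₀.ne'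
  have hB0 : (r₀:ℂ)^(n-1) * (∫ s in Ioi r₀, (s:ℂ)^(-n+1) * w s) = I * vinf * δ * σ := by
    rw [hrel]; field_simp
  clear hrel hBeq cG dG hhi hgi hg hgc hA hB hpos hT hu hL1 hL10
  generalize hAd : (fun r : ℝ => ∫ s in r₀..r, (s:ℂ)^(n+1) * w s) = A at *
  generalize hBd : (fun r : ℝ => ∫ s in Ioi r, (s:ℂ)^(-n+1) * w s) = B at *
  have eA : ∀ r : ℝ, (∫ s in r₀..r, (s:ℂ)^(n+1) * w s) = A r := fun r => by rw [← hAd]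
  have eB : ∀ r : ℝ, (∫ s in Ioi r, (s:ℂ)^(-n+1) * w s) = B r := fun r => by rw [← hBd]
  simp only [eA, eB] at *
  have cz := bs_zpow_cont r₀ hr₀
  -- continuity
  have c1 : ContinuousOn (fun r : ℝ => σ * (I * (r:ℂ)^(-n-1) / 2) * A r + σ * (I * (r:ℂ)^(n-1)/2) * B r + δ * vinf / 2) (Ici r₀) :=
    (((continuousOn_const.mul ((continuousOn_const.mul (cz _)).div_const _)).mul cA).add
      ((continuousOn_const.mul ((continuousOn_const.mul (cz _)).div_const _)).mul cB)).add continuousOn_const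
  have c2 : ContinuousOn (fun r : ℝ => (r:ℂ)^(-n-1) / 2 * A r - (r:ℂ)^(n-1)/2 * B r - σ * δ * vinf / (2 * I)) (Ici r₀) :=
    ((((cz _).div_const _).mul cA).sub
      (((cz _).div_const _).mul cB)).sub continuousOn_const
  -- limits
  have l1 : Tendsto (fun r : ℝ => σ * (I * (r:ℂ)^(-n-1) / 2) * A r + σ * (I * (r:ℂ)^(n-1)/2) * B r + δ * vinf / 2) atTop (nhds (δ * vinf / 2)) := by
    have := ((tA.const_mul (σ * I / 2)).add (tB.const_mul (σ * I / 2))).add_const (δ * vinf / 2)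
    simp only [mul_zero, zero_add] at this
    refine this.congr fun r => ?_
    ring
  have l2 : Tendsto (fun r : ℝ => (r:ℂ)^(-n-1) / 2 * A r - (r:ℂ)^(n-1)/2 * B r - σ * δ * vinf / (2 * I)) atTop (nhds (-σ * δ * vinf / (2 * I))) := by
    have := ((tA.const_mul (1 / 2)).sub (tB.const_mul (1 / 2))).sub_const (σ * δ * vinf / (2 * I))
    simp only [mul_zero, zero_sub, sub_zero] at this
    have e : -σ * δ * vinf / (2 * I) = -(σ * δ * vinf / (2 * I)) := by ring
    rw [e]
    refine this.congr fun r => ?_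
    ring
  have d1 : ∀ r, r₀ < r → DifferentiableAt ℝ (fun r : ℝ => σ * (I * (r:ℂ)^(-n-1) / 2) * A r + σ * (I * (r:ℂ)^(n-1)/2) * B r + δ * vinf / 2) r := by
    intro r hr
    have dz := fun m => (bs_zpow_deriv r (lt_trans hr₀ hr) m).differentiableAt
    exact (((((dz _).const_mul _).div_const _).const_mul _).mul (dA r hr).differentiableAt
      |>.add (((((dz _).const_mul _).div_const _).const_mul _).mul (dB r hr).differentiableAt)).add_const _
  have d2 : ∀ r, r₀ < r → DifferentiableAt ℝ (fun r : ℝ => (r:ℂ)^(-n-1) / 2 * A r - (r:ℂ)^(n-1)/2 * B r - σ * δ * vinf / (2 * I)) r := by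
    intro r hr
    have dz := fun m => (bs_zpow_deriv r (lt_trans hr₀ hr) m).differentiableAt
    exact ((((dz _).div_const _).mul (dA r hr).differentiableAt).sub
      (((dz _).div_const _).mul (dB r hr).differentiableAt)).sub_const _
  have hinv : ∀ x : ℂ, x / (2 * I) = - (I * x / 2) := by
    intro x
    field_simp
    rw [I_sq]; ring
  refine ⟨?_, fun r hr => ⟨d1 r hr, d2 r hr⟩, c1, c2, ?_, ?_, ?_, l1, l2⟩
  · obtain ⟨C1, h1⟩ := bs_bdd r₀ _ _ c1 l1
    obtain ⟨C2, h2⟩ := bs_bdd r₀ _ _ c2 l2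
    exact ⟨max C1 C2, fun r hr => ⟨(h1 r hr).trans (le_max_left _ _), (h2 r hr).trans (le_max_right _ _)⟩⟩
  · intro r hr
    have hr0 := lt_trans hr₀ hr
    have hrc : (r : ℂ) ≠ 0 := by exact_mod_cast hr0.ne'
    have hnear : ∀ᶠ x : ℝ in nhds r, (x : ℂ) ≠ 0 := by
      filter_upwards [Ioi_mem_nhds hr] with x hx
      exact_mod_cast (lt_trans hr₀ hx).ne'
    have dz := bs_zpow_deriv r hr0
    have hid : HasDerivAt (fun ρ : ℝ => (ρ : ℂ)) 1 r := Complex.ofRealCLM.hasDerivAt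
    have pA := (dz (-n)).mul (dA r hr)
    have pB := (dz n).mul (dB r hr)
    have z1 : (r:ℂ)^(-n) * (r:ℂ)^(n+1) = r := by
      rw [← zpow_add₀ hrc]; simp
    have z2 : (r:ℂ)^(n) * (r:ℂ)^(-n+1) = r := by
      rw [← zpow_add₀ hrc]; simp
    constructor
    · have hd := ((pA.add pB).const_mul (σ * I / 2)).add (hid.const_mul (δ * vinf / 2))
      have hd' := (hd.congr_of_eventuallyEq (f₁ := fun ρ : ℝ => (ρ:ℂ) * (σ * (I * (ρ:ℂ)^(-n-1) / 2) * A ρ + σ * (I * (ρ:ℂ)^(n-1)/2) * B ρ + δ * vinf / 2)) (by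
        filter_upwards [hnear] with x hx
        simp only [Pi.add_apply, Pi.mul_apply]
        rw [zpow_sub_one₀ hx, zpow_sub_one₀ hx]
        field_simp)).deriv
      rw [hd', hinv]
      apply mul_left_cancel₀ hrc
      push_cast
      field_simp
      linear_combination (σ * I * w r) * (z1 - z2) + n * σ^2 * δ * vinf * I_sq - δ * vinf * hσn - vinf * hnδ
    · have hd := ((pA.sub pB).const_mul (1 / 2)).sub (hid.const_mul (σ * δ * vinf / (2 * I)))
      have hd' := (hd.congr_of_eventuallyEq (f₁ := fun ρ : ℝ => (ρ:ℂ) * ((ρ:ℂ)^(-n-1) / 2 * A ρ - (ρ:ℂ)^(n-1)/2 * B ρ - σ * δ * vinf / (2 * I))) (by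
        filter_upwards [hnear] with x hx
        simp only [Pi.sub_apply, Pi.mul_apply]
        rw [zpow_sub_one₀ hx, zpow_sub_one₀ hx]
        field_simp)).deriv
      rw [hd', hinv]
      apply mul_left_cancel₀ hrc
      push_cast
      field_simp
      linear_combination (w r) * (z1 + z2) - I * σ * vinf * hnδ +
        ((r:ℂ)^(-n-1) * A r + (r:ℂ)^(n-1) * B r) * (hσn - n * σ^2 * I_sq)
  · rw [hA0]
    linear_combination (σ * I / 2) * hB0 + (vinf * δ * σ^2 / 2) * I_sq - vinf / 2 * hσδ
  · rw [hA0, hinv]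
    linear_combination (-1 / 2) * hB0

theorem biotSavart_polar (r₀ : ℝ) (hr₀ : 0 < r₀) (vinf : ℝ) (k : ℤ)
    (w : ℝ → ℂ) (hw : ContinuousOn w (Set.Ioi r₀))
    (hL1 : k ≠ 0 → IntegrableOn (fun s : ℝ => (Real.sqrt s : ℂ) * w s) (Set.Ioi r₀))
    (hL10 : k = 0 → IntegrableOn (fun s : ℝ => (s : ℂ) * w s) (Set.Ioi r₀))
    (hrel : (∫ s in Set.Ioi r₀, (s : ℂ) ^ (-(k.natAbs : ℤ) + 1) * w s)
      = Complex.I * vinf * deltaAbs1 k * (Int.sign k : ℂ) / (r₀ : ℂ) ^ ((k.natAbs : ℤ) - 1)) :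
    BSGood r₀ vinf k w (vrBS r₀ vinf k w) (vφBS r₀ vinf k w) ∧
    (∀ vr vφ : ℝ → ℂ, BSGood r₀ vinf k w vr vφ →
      ∀ r ∈ Set.Ici r₀, vr r = vrBS r₀ vinf k w r ∧ vφ r = vφBS r₀ vinf k w r) := by
  have h := bs_good r₀ hr₀ vinf k w hw hL1 hL10 hrel
  exact ⟨h, fun vr vφ h' => bs_unique r₀ hr₀ vinf k w vr vφ _ _ h' h⟩
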